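/- For every m ≥ 1, M > 0, α ∈ [0,1], and every partition ρ of {1, …, m}, the tRPM transition kernel is a valid transition probability: Σ_λ K_α(ρ, λ) = 1, where the sum runs over all partitions λ of {1, …, m}. -/

import Mathlib

open Finset

noncomputable section

/-- CRP(M) probability of a partition of a finite set `s` of `n = s.card` elements:
`p_n(ρ) = M^k ∏_j (|S_j| - 1)! / ∏_{i=1}^n (M + i - 1)`. -/
def crp {α : Type*} [DecidableEq α] (M : ℝ) {s : Finset α} (P : Finpartition s) : ℝ :=
  (M ^ P.parts.card * ∏ b ∈ P.parts, (Nat.factorial (b.card - 1) : ℝ)) /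
    ∏ i ∈ Finset.range s.card, (M + i)

/-- Restriction of a partition of `s` to a subset `A ⊆ s`: the clusters are the
nonempty intersections of the clusters with `A`. -/
def restrictPart {α : Type*} [DecidableEq α] {s : Finset α} (P : Finpartition s)
    (A : Finset α) (hA : A ⊆ s) : Finpartition A :=
  Finpartition.ofErase (P.parts.image (· ∩ A))
    (by
      rw [Finset.supIndep_iff_pairwiseDisjoint]
      rintro x hx y hy hxy
      simp only [coe_image, Set.mem_image, mem_coe] at hx hy
      obtain ⟨p, hp, rfl⟩ := hx
      obtain ⟨q, hq, rfl⟩ := hy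
      have hpq : p ≠ q := by rintro rfl; exact hxy rfl
      exact (P.disjoint hp hq hpq).mono inter_subset_left inter_subset_left)
    (by
      rw [Finset.sup_image]
      have : (P.parts.sup (id ∘ (· ∩ A))) = P.parts.sup id ⊓ A := by
        rw [Finset.sup_inf_distrib_right]
        rfl
      rw [this, P.sup_parts]
      exact inf_eq_right.mpr hA)

/-- The set `S(γ) = {i : γ i = 1}`. -/
def gammaSet {m : ℕ} (γ : Fin m → Bool) : Finset (Fin m) :=
  Finset.univ.filter (fun i => γ i = true)

/-- The one-step tRPM transition kernel `K_α(ρ, λ)`. -/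
def tK {m : ℕ} (M a : ℝ) (ρ lam : Finpartition (Finset.univ : Finset (Fin m))) : ℝ :=
  ∑ γ : Fin m → Bool,
    (∏ i, if γ i then a else 1 - a) *
      (if restrictPart lam (gammaSet γ) (Finset.subset_univ _) =
          restrictPart ρ (gammaSet γ) (Finset.subset_univ _) then 1 else 0) *
      (crp M lam / crp M (restrictPart lam (gammaSet γ) (Finset.subset_univ _)))

end

theorem mem_restrictPart {α : Type*} [DecidableEq α] {s : Finset α} (P : Finpartition s)
    (A : Finset α) (hA : A ⊆ s) (b : Finset α) :
    b ∈ (restrictPart P A hA).parts ↔ b ≠ ∅ ∧ ∃ p ∈ P.parts, p ∩ A = b := by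
  simp [restrictPart, Finpartition.ofErase]

theorem restrictPart_self {α : Type*} [DecidableEq α] {s : Finset α} (P : Finpartition s)
    (hA : s ⊆ s) : restrictPart P s hA = P := by
  ext b
  rw [mem_restrictPart]
  constructor
  · rintro ⟨_, p, hp, rfl⟩
    rwa [inter_eq_left.mpr (P.le hp)]
  · intro hb
    exact ⟨P.ne_bot hb, b, hb, inter_eq_left.mpr (P.le hb)⟩

theorem restrictPart_trans {α : Type*} [DecidableEq α] {s : Finset α} (P : Finpartition s)
    (B A : Finset α) (hB : B ⊆ s) (hA : A ⊆ B) :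
    restrictPart (restrictPart P B hB) A hA = restrictPart P A (hA.trans hB) := by
  ext b
  simp only [mem_restrictPart]
  constructor
  · rintro ⟨hb, p, ⟨_, q, hq, rfl⟩, rfl⟩
    refine ⟨hb, q, hq, ?_⟩
    rw [inter_assoc, inter_eq_right.mpr hA]
  · rintro ⟨hb, q, hq, rfl⟩
    have h : q ∩ B ∩ A = q ∩ A := by rw [inter_assoc, inter_eq_right.mpr hA]
    refine ⟨hb, q ∩ B, ⟨?_, q, hq, rfl⟩, h⟩
    intro h0
    rw [h0] at h
    exact hb (by rw [← h]; simp)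

theorem crp_pos {α : Type*} [DecidableEq α] {M : ℝ} (hM : 0 < M) {s : Finset α}
    (P : Finpartition s) : 0 < crp M P := by
  unfold crp
  have h1 : 0 < ∏ b ∈ P.parts, (Nat.factorial (b.card - 1) : ℝ) :=
    prod_pos fun b _ => by positivity
  have h2 : 0 < ∏ i ∈ Finset.range s.card, (M + i) := prod_pos fun b _ => by positivity
  positivity

theorem part_inter {α : Type*} [DecidableEq α] {A : Finset α} {x : α} (hx : x ∉ A)
    (P : Finpartition (insert x A)) : P.part x ∩ A = (P.part x).erase x := by
  have h1 : P.part x ⊆ insert x A := P.le (P.part_mem.2 (mem_insert_self x A))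
  ext y
  have := @h1 y
  simp only [mem_insert, mem_inter, mem_erase] at *
  grind

/-- Recover the parts from the restriction and the block of `x`. -/
theorem parts_eq {α : Type*} [DecidableEq α] {A : Finset α} {x : α} (hx : x ∉ A)
    (P : Finpartition (insert x A)) :
    P.parts = insert (insert x ((P.part x).erase x))
      ((restrictPart P A (subset_insert x A)).parts.erase ((P.part x).erase x)) := by
  have hxm : x ∈ P.part x := P.mem_part (mem_insert_self x A)
  have hpm : P.part x ∈ P.parts := P.part_mem.2 (mem_insert_self x A)
  have key : ∀ p ∈ P.parts, p ≠ P.part x → p ∩ A = p := by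
    intro p hp hne
    rw [inter_eq_left]
    intro y hy
    rcases mem_insert.1 (P.le hp hy) with rfl | h
    · exact absurd (P.part_eq_of_mem hp hy).symm hne
    · exact h
  ext b
  rw [mem_insert, mem_erase, mem_restrictPart, insert_erase hxm]
  constructor
  · intro hb
    by_cases h : b = P.part x
    · exact Or.inl h
    · refine Or.inr ⟨?_, P.ne_bot hb, b, hb, key b hb h⟩
      intro h2
      have hd := P.disjoint hb hpm h
      have : b ⊆ P.part x := h2 ▸ erase_subset _ _
      exact P.ne_bot hb (disjoint_self.1 (hd.mono_right this))
  · rintro (rfl | ⟨h1, h2, p, hp, rfl⟩)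
    · exact hpm
    · by_cases h : p = P.part x
      · subst h
        exact absurd (part_inter hx P) h1
      · rwa [key p hp h]

/-- Add `x` to block `t` of `Q` (or as a singleton when `t = ∅`). -/
theorem exists_ext {α : Type*} [DecidableEq α] {A : Finset α} {x : α} (hx : x ∉ A)
    (Q : Finpartition A) (t : Finset α) (ht : t ∈ insert ∅ Q.parts) :
    ∃ P : Finpartition (insert x A), restrictPart P A (subset_insert x A) = Q ∧
      (P.part x).erase x = t := by
  have htA : t ⊆ A := by
    rcases mem_insert.1 ht with rfl | h
    · simp
    · exact Q.le h
  have hxt : x ∉ t := fun h => hx (htA h)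
  have hdis : ∀ b ∈ Q.parts, b ≠ t → Disjoint t b := by
    intro b hb hne
    rcases mem_insert.1 ht with rfl | h
    · simp
    · exact Q.disjoint h hb hne.symm
  have hxb : ∀ b ∈ Q.parts, x ∉ b := fun b hb h => hx (Q.le hb h)
  let P : Finpartition (insert x A) :=
    { parts := insert (insert x t) (Q.parts.erase t)
      supIndep := by
        rw [Finset.supIndep_iff_pairwiseDisjoint]
        intro b hb c hc hbc
        simp only [coe_insert, coe_erase, Set.mem_insert_iff, Set.mem_sdiff, mem_coe,
          Set.mem_singleton_iff] at hb hc
        change Disjoint b c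
        rcases hb with rfl | ⟨hb, hb'⟩ <;> rcases hc with rfl | ⟨hc, hc'⟩
        · exact absurd rfl hbc
        · rw [disjoint_insert_left]; exact ⟨hxb c hc, hdis c hc hc'⟩
        · rw [disjoint_insert_right]; exact ⟨hxb b hb, (hdis b hb hb').symm⟩
        · exact Q.disjoint hb hc hbc
      sup_parts := by
        ext y
        simp only [mem_sup, mem_insert, mem_erase, id]
        constructor
        · rintro ⟨b, rfl | ⟨_, hb⟩, hy⟩
          · rcases mem_insert.1 hy with h | h
            · exact Or.inl h
            · exact Or.inr (htA h)
          · exact Or.inr (Q.le hb hy)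
        · rintro (rfl | hy)
          · exact ⟨_, Or.inl rfl, mem_insert_self _ _⟩
          · by_cases hyt : y ∈ t
            · exact ⟨_, Or.inl rfl, mem_insert_of_mem hyt⟩
            · refine ⟨Q.part y, Or.inr ⟨?_, Q.part_mem.2 hy⟩, Q.mem_part hy⟩
              rintro rfl
              exact hyt (Q.mem_part hy)
      bot_notMem := by
        simp only [mem_insert, mem_erase, not_or, bot_eq_empty]
        exact ⟨(insert_ne_empty _ _).symm, fun h => Q.bot_notMem h.2⟩ }
  have hpx : P.part x = insert x t :=
    P.part_eq_of_mem (mem_insert_self _ _) (mem_insert_self _ _)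
  refine ⟨P, ?_, by rw [hpx, erase_insert hxt]⟩
  have h1 : insert x t ∩ A = t := by
    rw [insert_inter_of_notMem hx, inter_eq_left.2 htA]
  have hm : ∀ p, p ∈ P.parts ↔ p = insert x t ∨ (p ≠ t ∧ p ∈ Q.parts) := by
    intro p
    change p ∈ insert (insert x t) (Q.parts.erase t) ↔ _
    simp
  ext b
  rw [mem_restrictPart]
  constructor
  · rintro ⟨hb, p, hp, rfl⟩
    rcases (hm p).1 hp with rfl | ⟨_, hp⟩
    · rw [h1] at hb ⊢
      exact (mem_insert.1 ht).resolve_left hb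
    · rwa [inter_eq_left.2 (Q.le hp)]
  · intro hb
    refine ⟨Q.ne_bot hb, ?_⟩
    by_cases h : b = t
    · exact ⟨insert x t, (hm _).2 (Or.inl rfl), by rw [h1, h]⟩
    · exact ⟨b, (hm _).2 (Or.inr ⟨h, hb⟩), inter_eq_left.2 (Q.le hb)⟩

theorem crp_ext {α : Type*} [DecidableEq α] {M : ℝ} (hM : 0 < M) {A : Finset α} {x : α}
    (hx : x ∉ A) (Q : Finpartition A) (t : Finset α) (ht : t ∈ insert ∅ Q.parts)
    (P : Finpartition (insert x A))
    (hP : P.parts = insert (insert x t) (Q.parts.erase t)) :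
    crp M P = crp M Q * ((if t = ∅ then M else (t.card : ℝ)) / (M + A.card)) := by
  have htA : t ⊆ A := by
    rcases mem_insert.1 ht with rfl | h
    · simp
    · exact Q.le h
  have hxt : x ∉ t := fun h => hx (htA h)
  have hn : insert x t ∉ Q.parts.erase t := fun h =>
    hx (Q.le (mem_of_mem_erase h) (mem_insert_self _ _))
  have h2 : 0 < ∏ i ∈ Finset.range A.card, (M + i) := prod_pos fun b _ => by positivity
  have h3 : 0 < M + A.card := by positivity
  unfold crp
  rw [hP, prod_insert hn, card_insert_of_notMem hn, card_insert_of_notMem hx, prod_range_succ,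
    card_insert_of_notMem hxt]
  by_cases h0 : t = ∅
  · have : Q.parts.erase t = Q.parts := by
      rw [h0]; exact erase_eq_of_notMem Q.bot_notMem
    rw [this, if_pos h0, h0]
    simp only [card_empty, Nat.zero_add, Nat.sub_self, Nat.factorial_zero, Nat.cast_one]
    field_simp
    rw [pow_succ, mul_comm]
  · have htQ := (mem_insert.1 ht).resolve_left h0
    rw [if_neg h0, card_erase_add_one htQ, ← mul_prod_erase Q.parts _ htQ]
    have hc : t.card ≠ 0 := by simpa using h0
    have : ((t.card + 1 - 1).factorial : ℝ) = t.card * (t.card - 1).factorial := by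
      rw [Nat.add_sub_cancel, ← Nat.mul_factorial_pred hc]; push_cast; ring
    rw [this]
    field_simp

theorem crp_step {α : Type*} [DecidableEq α] {M : ℝ} (hM : 0 < M) {A : Finset α} {x : α}
    (hx : x ∉ A) (Q : Finpartition A) :
    (∑ P : Finpartition (insert x A),
      if restrictPart P A (subset_insert x A) = Q then crp M P else 0) = crp M Q := by
  rw [← sum_filter]
  have h3 : 0 < M + A.card := by positivity
  have : ∑ P : Finpartition (insert x A) with restrictPart P A (subset_insert x A) = Q, crp M P
      = ∑ t ∈ insert ∅ Q.parts,
        crp M Q * ((if t = ∅ then M else (t.card : ℝ)) / (M + A.card)) := by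
    have hmem : ∀ P : Finpartition (insert x A), restrictPart P A (subset_insert x A) = Q →
        (P.part x).erase x ∈ insert ∅ Q.parts := by
      intro P hP
      by_cases h : (P.part x).erase x = ∅
      · rw [h]; exact mem_insert_self _ _
      · refine mem_insert_of_mem ?_
        rw [← hP, mem_restrictPart]
        exact ⟨h, _, P.part_mem.2 (mem_insert_self x A), part_inter hx P⟩
    refine sum_bij (fun P _ => (P.part x).erase x) ?_ ?_ ?_ ?_
    · intro P hP
      exact hmem P (mem_filter.1 hP).2
    · intro P hP P' hP' h
      ext1
      rw [parts_eq hx P, parts_eq hx P', (mem_filter.1 hP).2, (mem_filter.1 hP').2, h]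
    · intro t ht
      obtain ⟨P, h1, h2⟩ := exists_ext hx Q t ht
      exact ⟨P, mem_filter.2 ⟨mem_univ _, h1⟩, h2⟩
    · intro P hP
      have hP := (mem_filter.1 hP).2
      refine crp_ext hM hx Q _ (hmem P hP) P ?_
      conv_lhs => rw [parts_eq hx P, hP]
  rw [this, ← mul_sum, ← sum_div, sum_insert (by exact Q.bot_notMem), if_pos rfl]
  have : ∑ t ∈ Q.parts, (if t = ∅ then M else (t.card : ℝ)) = A.card := by
    rw [← Q.sum_card_parts]
    push_cast
    exact sum_congr rfl fun t ht => if_neg (Q.ne_bot ht)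
  rw [this, div_self h3.ne', mul_one]

theorem crp_marginal {α : Type*} [DecidableEq α] {M : ℝ} (hM : 0 < M) {A : Finset α}
    (Q : Finpartition A) : ∀ (n : ℕ) (s : Finset α) (hA : A ⊆ s), (s \ A).card = n →
    (∑ P : Finpartition s, if restrictPart P A hA = Q then crp M P else 0) = crp M Q := by
  intro n
  induction n with
  | zero =>
    intro s hA hc
    obtain rfl : A = s := hA.antisymm (sdiff_eq_empty_iff_subset.1 (card_eq_zero.1 hc))
    simp [restrictPart_self]
  | succ n ih =>
    intro s hA hc
    obtain ⟨x, hxs⟩ : (s \ A).Nonempty := card_pos.1 (by omega)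
    obtain ⟨hxs, hxA⟩ := mem_sdiff.1 hxs
    obtain ⟨s', hx, rfl⟩ : ∃ s', x ∉ s' ∧ insert x s' = s :=
      ⟨s.erase x, notMem_erase _ _, insert_erase hxs⟩
    have hA' : A ⊆ s' := (subset_insert_iff_of_notMem hxA).1 hA
    have hc' : (s' \ A).card = n := by
      rw [insert_sdiff_of_notMem _ hxA, card_insert_of_notMem (by simp [hx])] at hc
      omega
    rw [← ih s' hA' hc']
    have : ∀ μ : Finpartition s', (if restrictPart μ A hA' = Q then crp M μ else 0) =
        ∑ P : Finpartition (insert x s'), if restrictPart P s' (subset_insert x s') = μ then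
          (if restrictPart μ A hA' = Q then crp M P else 0) else 0 := by
      intro μ
      split_ifs with h
      · exact (crp_step hM hx μ).symm
      · simp
    simp_rw [this]
    rw [sum_comm]
    refine sum_congr rfl fun P _ => ?_
    rw [sum_ite_eq]
    simp [restrictPart_trans]

/-- the tRPM transition kernel is a valid transition probability:
for every `m ≥ 1`, `M > 0`, `α ∈ [0,1]` and partition `ρ` of `{1,…,m}`,
`Σ_λ K_α(ρ, λ) = 1`. -/
theorem statement4 (m : ℕ) (hm : 1 ≤ m) (M : ℝ) (hM : 0 < M)
    (a : ℝ) (ha : a ∈ Set.Icc (0 : ℝ) 1)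
    (ρ : Finpartition (Finset.univ : Finset (Fin m))) :
    ∑ lam : Finpartition (Finset.univ : Finset (Fin m)), tK M a ρ lam = 1 := by
  unfold tK
  rw [sum_comm]
  have h : ∀ γ : Fin m → Bool, ∑ lam : Finpartition (Finset.univ : Finset (Fin m)),
      (∏ i, if γ i then a else 1 - a) *
      (if restrictPart lam (gammaSet γ) (Finset.subset_univ _) =
          restrictPart ρ (gammaSet γ) (Finset.subset_univ _) then 1 else 0) *
      (crp M lam / crp M (restrictPart lam (gammaSet γ) (Finset.subset_univ _))) =
      ∏ i, if γ i then a else 1 - a := by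
    intro γ
    have hp := crp_pos hM (restrictPart ρ (gammaSet γ) (Finset.subset_univ _))
    have hs := crp_marginal hM (restrictPart ρ (gammaSet γ) (Finset.subset_univ _)) _
      univ (Finset.subset_univ _) rfl
    simp_rw [mul_assoc]
    rw [← mul_sum]
    refine Eq.trans (congrArg _ ?_) (mul_one _)
    refine Eq.trans (Eq.trans ?_
      (congrArg (· / crp M (restrictPart ρ (gammaSet γ) (Finset.subset_univ _))) hs))
      (div_self hp.ne')
    beta_reduce
    rw [sum_div]
    refine sum_congr rfl fun lam _ => ?_
    split_ifs with h
    · rw [h, one_mul]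
    · simp
  rw [sum_congr rfl fun γ _ => h γ]
  have := Finset.prod_univ_sum (fun _ : Fin m => (univ : Finset Bool))
    (fun _ b => if b then a else 1 - a)
  rw [Fintype.piFinset_univ] at this
  rw [← this]
  simp
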